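/- arXiv:1508.02374 — 5 statements merged into one kernel-verified Lean document; each statement's English description precedes it below -/
import Mathlib

section
/- For the specific channel W and decoding metric q given below, the primal LM rate satisfies I_LM(Q) ≤ 0.1369 nats/use for every input distribution Q on {0,1}; in particular C_LM := sup_Q I_LM(Q) ≤ 0.1369. -/
open scoped BigOperators

/-- The channel `W(y|x)` of the counter-example. -/
noncomputable def W : Fin 2 → Fin 3 → ℝ := ![![0.97, 0.03, 0], ![0.1, 0.1, 0.8]]

/-- The decoding metric `q(x,y)` of the counter-example. -/
noncomputable def q : Fin 2 → Fin 3 → ℝ := ![![1, 1, 1], ![1, 0.5, 1.36]]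

/-- Output distribution induced by input distribution `Q`. -/
noncomputable def PY (Q : Fin 2 → ℝ) (y : Fin 3) : ℝ := ∑ x, Q x * W x y

/-- The primal LM rate `I_LM(Q)`. -/
noncomputable def ILM (Q : Fin 2 → ℝ) : ℝ :=
  sInf { r : ℝ | ∃ P : Fin 2 → Fin 3 → ℝ,
    (∀ x y, 0 ≤ P x y) ∧
    (∀ x, ∑ y, P x y = Q x) ∧
    (∀ y, ∑ x, P x y = PY Q y) ∧
    (∑ x, ∑ y, Q x * W x y * Real.log (q x y)) ≤ (∑ x, ∑ y, P x y * Real.log (q x y)) ∧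
    r = ∑ x, ∑ y, P x y * Real.log (P x y / ((∑ y', P x y') * (∑ x', P x' y))) }

open Real

/-- The mutual information of a joint distribution with marginals `Q` and `PY Q` that satisfies
the metric constraint bounds the LM rate. -/
lemma ILM_le_of_feasible {Q : Fin 2 → ℝ} {P : Fin 2 → Fin 3 → ℝ} (hP : ∀ x y, 0 ≤ P x y)
    (hX : ∀ x, ∑ y, P x y = Q x) (hY : ∀ y, ∑ x, P x y = PY Q y)
    (hq : (∑ x, ∑ y, Q x * W x y * log (q x y)) ≤ ∑ x, ∑ y, P x y * log (q x y)) :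
    ILM Q ≤ (∑ x, ∑ y, P x y * log (P x y)) - (∑ x, Q x * log (Q x))
      - ∑ y, PY Q y * log (PY Q y) := by
  have key : ∀ x y, P x y * log (P x y / (Q x * PY Q y)) =
      P x y * log (P x y) - P x y * log (Q x) - P x y * log (PY Q y) := by
    intro x y
    rcases (hP x y).eq_or_lt with h | h
    · simp [← h]
    · have hx : 0 < Q x := h.trans_le <| hX x ▸
        Finset.single_le_sum (f := fun y ↦ P x y) (fun y _ ↦ hP x y) (Finset.mem_univ y)
      have hy : 0 < PY Q y := h.trans_le <| hY y ▸
        Finset.single_le_sum (f := fun x ↦ P x y) (fun x _ ↦ hP x y) (Finset.mem_univ x)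
      rw [log_div h.ne' (by positivity), log_mul hx.ne' hy.ne']
      ring
  have hbdd : BddBelow { r : ℝ | ∃ P : Fin 2 → Fin 3 → ℝ,
      (∀ x y, 0 ≤ P x y) ∧
      (∀ x, ∑ y, P x y = Q x) ∧
      (∀ y, ∑ x, P x y = PY Q y) ∧
      (∑ x, ∑ y, Q x * W x y * Real.log (q x y)) ≤ (∑ x, ∑ y, P x y * Real.log (q x y)) ∧
      r = ∑ x, ∑ y, P x y * Real.log (P x y / ((∑ y', P x y') * (∑ x', P x' y))) } := by
    refine ⟨∑ x, ∑ y, -(Q x * PY Q y), ?_⟩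
    rintro r ⟨R, hR, hRX, hRY, -, rfl⟩
    refine Finset.sum_le_sum fun x _ ↦ Finset.sum_le_sum fun y _ ↦ ?_
    rw [hRX, hRY]
    have hx : R x y ≤ Q x := hRX x ▸
      Finset.single_le_sum (f := fun y ↦ R x y) (fun y _ ↦ hR x y) (Finset.mem_univ y)
    have hy : R x y ≤ PY Q y := hRY y ▸
      Finset.single_le_sum (f := fun x ↦ R x y) (fun x _ ↦ hR x y) (Finset.mem_univ x)
    rcases (hR x y).eq_or_lt with h | h
    · rw [← h] at hx hy ⊢
      simp only [zero_mul]
      have := mul_nonneg hx hy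
      linarith
    · have hm : 0 < Q x * PY Q y := mul_pos (h.trans_le hx) (h.trans_le hy)
      have h1 := one_sub_inv_le_log_of_pos (div_pos h hm)
      rw [inv_div] at h1
      have h2 := mul_le_mul_of_nonneg_left h1 h.le
      have h3 : R x y * (1 - Q x * PY Q y / R x y) = R x y - Q x * PY Q y := by
        field_simp
      linarith
  refine (csInf_le hbdd ⟨P, hP, hX, hY, hq, rfl⟩).trans_eq ?_
  simp only [hX, hY, key, Finset.sum_sub_distrib]
  congr 1
  · congr 1
    refine Finset.sum_congr rfl fun x _ ↦ ?_
    rw [← Finset.sum_mul, hX]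
  · rw [Finset.sum_comm]
    refine Finset.sum_congr rfl fun y _ ↦ ?_
    rw [← Finset.sum_mul, hY]

/-- Two-sided bounds on `log x` from the series of `log ((1 + z) / (1 - z))` after scaling `x`
by a power of two. -/
lemma log_bounds (k : ℕ) {x z l u : ℝ} (hz : 0 ≤ z := by norm_num) (hz1 : z < 1 := by norm_num)
    (hx : x * 2 ^ k * (1 - z) = 1 + z := by norm_num)
    (hl : l ≤ 2 * (∑ i ∈ Finset.range 8, z ^ (2 * i + 1) / (2 * i + 1)) - k * 0.6931471808 := by
      norm_num [Finset.sum_range_succ])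
    (hu : 2 * ((∑ i ∈ Finset.range 8, z ^ (2 * i + 1) / (2 * i + 1))
      + z ^ (2 * 8 + 1) / (1 - z ^ 2)) - k * 0.6931471803 ≤ u := by
      norm_num [Finset.sum_range_succ]) :
    l ≤ log x ∧ log x ≤ u := by
  have h1 := sum_range_le_log_div hz hz1 8
  have h2 := log_div_le_sum_range_add hz hz1 8
  have hz' : 0 < 1 - z := by linarith
  have hxz : (1 + z) / (1 - z) = x * 2 ^ k := by rw [← hx]; field_simp
  have hx0 : x ≠ 0 := by
    rintro rfl
    linarith
  rw [hxz, log_mul hx0 (by positivity), log_pow] at h1 h2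
  have hk : (0 : ℝ) ≤ k := k.cast_nonneg
  have h3 := mul_le_mul_of_nonneg_left log_two_gt_d9.le hk
  have h4 := mul_le_mul_of_nonneg_left log_two_lt_d9.le hk
  constructor <;> linarith

/-- The masses `P(1,1) = u` and `P(1,2) = v` determine a feasible joint distribution for the input
distribution `(1 - a, a)`. -/
structure Admissible (a u v : ℝ) : Prop where
  u_nonneg : 0 ≤ u
  v_nonneg : 0 ≤ v
  p10 : 0 ≤ a - u - v
  p00 : 0 ≤ 0.97 - 0.87 * a - (a - u - v)
  p01 : 0 ≤ 0.03 + 0.07 * a - u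
  p02 : 0 ≤ 0.8 * a - v
  u_le : 0 ≤ 0.1 * a - u
  metric : 0.8 * a - v ≤ 2.2542 * (0.1 * a - u)

lemma Admissible.convex_comb {a u v a' u' v' s t : ℝ} (h : Admissible a u v)
    (h' : Admissible a' u' v') (hs : 0 ≤ s) (ht : 0 ≤ t) (hst : s + t = 1) :
    Admissible (s * a + t * a') (s * u + t * u') (s * v + t * v') := by
  obtain rfl : s = 1 - t := by linarith
  constructor
  · nlinarith [mul_nonneg hs h.1, mul_nonneg ht h'.1]
  · nlinarith [mul_nonneg hs h.2, mul_nonneg ht h'.2]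
  · nlinarith [mul_nonneg hs h.3, mul_nonneg ht h'.3]
  · nlinarith [mul_nonneg hs h.4, mul_nonneg ht h'.4]
  · nlinarith [mul_nonneg hs h.5, mul_nonneg ht h'.5]
  · nlinarith [mul_nonneg hs h.6, mul_nonneg ht h'.6]
  · nlinarith [mul_nonneg hs h.7, mul_nonneg ht h'.7]
  · nlinarith [mul_le_mul_of_nonneg_left h.8 hs, mul_le_mul_of_nonneg_left h'.8 ht]

/-- The negative joint entropy of the distribution described by `Admissible`. -/
noncomputable def negEntropy (a u v : ℝ) : ℝ :=
  (0.97 - 0.87 * a - (a - u - v)) * log (0.97 - 0.87 * a - (a - u - v))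
    + (0.03 + 0.07 * a - u) * log (0.03 + 0.07 * a - u)
    + (0.8 * a - v) * log (0.8 * a - v)
    + (a - u - v) * log (a - u - v) + u * log u + v * log v

lemma log_metric_ratio : 2.2542 * log 1.36 ≤ log 2 := by
  have h := log_bounds 0 (x := 1.36) (z := 9 / 59) (l := 0) (u := 0.3074847)
  linarith [h.2, log_two_gt_d9]

lemma ILM_le_of_admissible {Q : Fin 2 → ℝ} (hQ : ∑ x, Q x = 1) {u v : ℝ}
    (h : Admissible (Q 1) u v) :
    ILM Q ≤ negEntropy (Q 1) u v - ((1 - Q 1) * log (1 - Q 1) + Q 1 * log (Q 1))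
      - ((0.97 - 0.87 * Q 1) * log (0.97 - 0.87 * Q 1)
        + (0.03 + 0.07 * Q 1) * log (0.03 + 0.07 * Q 1)
        + (0.8 * Q 1) * log (0.8 * Q 1)) := by
  obtain ⟨h1, h2, h3, h4, h5, h6, h7, h8⟩ := h
  have hQ0 : Q 0 = 1 - Q 1 := by
    rw [Fin.sum_univ_two] at hQ
    linarith
  generalize ha : Q 1 = a at *
  have hY : PY Q = ![0.97 - 0.87 * a, 0.03 + 0.07 * a, 0.8 * a] := by
    funext y
    fin_cases y <;> simp [PY, W, hQ0, ha] <;> ring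
  have hf := ILM_le_of_feasible (Q := Q)
    (P := ![![0.97 - 0.87 * a - (a - u - v), 0.03 + 0.07 * a - u, 0.8 * a - v],
      ![a - u - v, u, v]])
    (by intro x y; fin_cases x <;> fin_cases y <;> simp <;> linarith)
    (by intro x; fin_cases x <;> simp [Fin.sum_univ_three, hQ0, ha] <;> ring)
    (by intro y; fin_cases y <;> simp [hY])
    (by
      have hlog : log 0.5 = -log 2 := by
        rw [← log_inv]
        norm_num
      have hpos : 0 ≤ log 1.36 := log_nonneg (by norm_num)
      have e1 := mul_le_mul_of_nonneg_right h8 hpos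
      have e2 := mul_le_mul_of_nonneg_left log_metric_ratio h7
      simp only [Fin.sum_univ_two, Fin.sum_univ_three, q, W, ha, Matrix.cons_val_zero,
        Matrix.cons_val_one, Matrix.cons_val, log_one, mul_zero, add_zero, zero_add, hlog]
      linarith)
  refine hf.trans_eq ?_
  simp only [hY, negEntropy, Fin.sum_univ_two, Fin.sum_univ_three, ha, hQ0, Matrix.cons_val_zero,
    Matrix.cons_val_one, Matrix.cons_val]
  ring

/-- The divergence of the distribution described by `Admissible` from the product of the input
distribution `(1 - r, r)` and its output distribution. -/
noncomputable def crossInfo (r a u v : ℝ) : ℝ :=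
  negEntropy a u v - ((1 - a) * log (1 - r) + a * log r)
    - ((0.97 - 0.87 * a) * log (0.97 - 0.87 * r) + (0.03 + 0.07 * a) * log (0.03 + 0.07 * r)
      + (0.8 * a) * log (0.8 * r))

lemma mul_log_tangent {x y : ℝ} (hx : 0 ≤ x) (hy : 0 < y) :
    x * log y + x - y ≤ x * log x := by
  rcases hx.eq_or_lt with rfl | hx
  · simpa using hy.le
  · have h1 := mul_le_mul_of_nonneg_left (one_sub_inv_le_log_of_pos (div_pos hx hy)) hx.le
    rw [inv_div, log_div hx.ne' hy.ne'] at h1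
    have h2 : x * (1 - y / x) = x - y := by field_simp
    linarith

lemma ILM_le_crossInfo {Q : Fin 2 → ℝ} (hQ : ∑ x, Q x = 1) {r u v : ℝ} (hr : 0 < r) (hr1 : r < 1)
    (h0 : 0 ≤ Q 1) (h1 : Q 1 ≤ 1) (h : Admissible (Q 1) u v) :
    ILM Q ≤ crossInfo r (Q 1) u v := by
  refine (ILM_le_of_admissible hQ h).trans ?_
  unfold crossInfo
  have t1 := mul_log_tangent (x := 1 - Q 1) (y := 1 - r) (by linarith) (by linarith)
  have t2 := mul_log_tangent h0 hr
  have t3 := mul_log_tangent (x := 0.97 - 0.87 * Q 1) (y := 0.97 - 0.87 * r)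
    (by linarith) (by linarith)
  have t4 := mul_log_tangent (x := 0.03 + 0.07 * Q 1) (y := 0.03 + 0.07 * r)
    (by linarith) (by linarith)
  have t5 := mul_log_tangent (x := 0.8 * Q 1) (y := 0.8 * r) (by linarith) (by linarith)
  linarith

lemma crossInfo_convex_comb {r a u v a' u' v' s t : ℝ} (h : Admissible a u v)
    (h' : Admissible a' u' v') (hs : 0 ≤ s) (ht : 0 ≤ t) (hst : s + t = 1) :
    crossInfo r (s * a + t * a') (s * u + t * u') (s * v + t * v')
      ≤ s * crossInfo r a u v + t * crossInfo r a' u' v' := by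
  have key : ∀ {x y z : ℝ}, 0 ≤ x → 0 ≤ y → z = s * x + t * y →
      z * log z ≤ s * (x * log x) + t * (y * log y) := by
    rintro x y z hx hy rfl
    exact convexOn_mul_log.2 hx hy hs ht hst
  obtain rfl : s = 1 - t := by linarith
  unfold crossInfo negEntropy
  linarith [key h.1 h'.1 rfl, key h.2 h'.2 rfl,
    key h.3 h'.3 (z := (1 - t) * a + t * a' - ((1 - t) * u + t * u') - ((1 - t) * v + t * v'))
      (by ring),
    key h.4 h'.4 (z := 0.97 - 0.87 * ((1 - t) * a + t * a') - ((1 - t) * a + t * a'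
      - ((1 - t) * u + t * u') - ((1 - t) * v + t * v'))) (by ring),
    key h.5 h'.5 (z := 0.03 + 0.07 * ((1 - t) * a + t * a') - ((1 - t) * u + t * u')) (by ring),
    key h.6 h'.6 (z := 0.8 * ((1 - t) * a + t * a') - ((1 - t) * v + t * v')) (by ring)]

/-- By convexity, it suffices to bound `crossInfo` at the ends of an interval. -/
lemma ILM_le_of_endpoints {Q : Fin 2 → ℝ} (hQ : ∑ x, Q x = 1) {r B a u v a' u' v' : ℝ}
    (hr : 0 < r) (hr1 : r < 1) (ha0 : 0 ≤ a) (haa : a < a') (ha1 : a' ≤ 1)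
    (h : Admissible a u v) (h' : Admissible a' u' v')
    (hB : crossInfo r a u v ≤ B) (hB' : crossInfo r a' u' v' ≤ B) (hQa : a ≤ Q 1) (hQa' : Q 1 ≤ a') :
    ILM Q ≤ B := by
  have hd : 0 < a' - a := by linarith
  set t := (Q 1 - a) / (a' - a) with ht_def
  have ht : 0 ≤ t := div_nonneg (by linarith) hd.le
  have ht1 : 0 ≤ 1 - t := by
    rw [sub_nonneg, ht_def, div_le_one hd]
    linarith
  have hQt : Q 1 = (1 - t) * a + t * a' := by
    rw [ht_def]
    field_simp
    ring
  have hadm := h.convex_comb h' ht1 ht (by ring)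
  rw [← hQt] at hadm
  refine (ILM_le_crossInfo hQ hr hr1 (by linarith) (by linarith) hadm).trans ?_
  rw [hQt]
  refine (crossInfo_convex_comb h h' ht1 ht (by ring)).trans ?_
  nlinarith [mul_le_mul_of_nonneg_left hB ht1, mul_le_mul_of_nonneg_left hB' ht]

lemma negEntropy_at_0_44 : negEntropy 0.44 0 0.2529 ≤ -1.427 := by
  have := log_bounds 2 (x := 0.97 - 0.87 * 0.44 - (0.44 - 0 - 0.2529)) (z := 1501 / 6501)
    (l := -0.91606) (u := -0.91603)
  have := log_bounds 5 (x := 0.03 + 0.07 * 0.44 - 0) (z := 591 / 1841)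
    (l := -2.80018) (u := -2.80015)
  have := log_bounds 4 (x := 0.8 * 0.44 - 0.2529) (z := 183 / 808)
    (l := -2.31164) (u := -2.31161)
  have := log_bounds 3 (x := 0.44 - 0 - 0.2529) (z := 621 / 3121)
    (l := -1.67613) (u := -1.67610)
  have := log_bounds 2 (x := 0.2529) (z := 29 / 5029)
    (l := -1.37478) (u := -1.37475)
  unfold negEntropy
  linarith

lemma negEntropy_at_0_62 : negEntropy 0.62 0.01 0.379 ≤ -1.499 := by
  have := log_bounds 3 (x := 0.97 - 0.87 * 0.62 - (0.62 - 0.01 - 0.379)) (z := 373 / 1623)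
    (l := -1.61145) (u := -1.61142)
  have := log_bounds 4 (x := 0.03 + 0.07 * 0.62 - 0.01) (z := 9 / 1259)
    (l := -2.75831) (u := -2.75828)
  have := log_bounds 4 (x := 0.8 * 0.62 - 0.379) (z := 109 / 359)
    (l := -2.14560) (u := -2.14557)
  have := log_bounds 3 (x := 0.62 - 0.01 - 0.379) (z := 53 / 178)
    (l := -1.46535) (u := -1.46532)
  have := log_bounds 7 (x := 0.01) (z := 7 / 57)
    (l := -4.60519) (u := -4.60516)
  have := log_bounds 2 (x := 0.379) (z := 129 / 629)
    (l := -0.97023) (u := -0.97020)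
  unfold negEntropy
  linarith

lemma negEntropy_at_0_82 : negEntropy 0.82 0.04 0.562 ≤ -1.277 := by
  have := log_bounds 5 (x := 0.97 - 0.87 * 0.82 - (0.82 - 0.04 - 0.562)) (z := 147 / 1397)
    (l := -3.25452) (u := -3.25449)
  have := log_bounds 5 (x := 0.03 + 0.07 * 0.82 - 0.04) (z := 323 / 1573)
    (l := -3.04915) (u := -3.04912)
  have := log_bounds 4 (x := 0.8 * 0.82 - 0.562) (z := 63 / 313)
    (l := -2.36448) (u := -2.36445)
  have := log_bounds 3 (x := 0.82 - 0.04 - 0.562) (z := 93 / 343)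
    (l := -1.52328) (u := -1.52325)
  have := log_bounds 5 (x := 0.04) (z := 7 / 57)
    (l := -3.21889) (u := -3.21886)
  have := log_bounds 1 (x := 0.562) (z := 31 / 531)
    (l := -0.57627) (u := -0.57624)
  unfold negEntropy
  linarith

lemma negEntropy_at_1 : negEntropy 1 0.1 0.8 ≤ -0.639 := by
  have := log_bounds 4 (x := 1 - 0.1 - 0.8) (z := 3 / 13)
    (l := -2.30260) (u := -2.30257)
  have := log_bounds 4 (x := 0.1) (z := 3 / 13)
    (l := -2.30260) (u := -2.30257)
  have := log_bounds 1 (x := 0.8) (z := 3 / 13)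
    (l := -0.22316) (u := -0.22313)
  unfold negEntropy
  linarith

lemma ILM_le_of_mem_0_44_0_62 {Q : Fin 2 → ℝ} (hQ : ∑ x, Q x = 1) (h : 0.44 ≤ Q 1)
    (h' : Q 1 ≤ 0.62) : ILM Q ≤ 0.1369 := by
  have := log_bounds 1 (x := 1 - 0.5) (z := 0)
    (l := -0.69316) (u := -0.69313)
  have := log_bounds 1 (x := 0.5) (z := 0)
    (l := -0.69316) (u := -0.69313)
  have := log_bounds 1 (x := 0.97 - 0.87 * 0.5) (z := 7 / 207)
    (l := -0.62550) (u := -0.62547)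
  have := log_bounds 4 (x := 0.03 + 0.07 * 0.5) (z := 1 / 51)
    (l := -2.73338) (u := -2.73335)
  have := log_bounds 2 (x := 0.8 * 0.5) (z := 3 / 13)
    (l := -0.91631) (u := -0.91628)
  refine ILM_le_of_endpoints hQ (r := 0.5) (a := 0.44) (u := 0) (v := 0.2529) (a' := 0.62)
    (u' := 0.01) (v' := 0.379) (by norm_num) (by norm_num) (by norm_num) (by norm_num)
    (by norm_num) (by constructor <;> norm_num) (by constructor <;> norm_num) ?_ ?_ h h'
  · unfold crossInfo
    linarith [negEntropy_at_0_44]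
  · unfold crossInfo
    linarith [negEntropy_at_0_62]

lemma ILM_le_of_mem_0_62_0_82 {Q : Fin 2 → ℝ} (hQ : ∑ x, Q x = 1) (h : 0.62 ≤ Q 1)
    (h' : Q 1 ≤ 0.82) : ILM Q ≤ 0.1369 := by
  have := log_bounds 2 (x := 1 - 0.7) (z := 1 / 11)
    (l := -1.20399) (u := -1.20396)
  have := log_bounds 1 (x := 0.7) (z := 1 / 6)
    (l := -0.35669) (u := -0.35666)
  have := log_bounds 2 (x := 0.97 - 0.87 * 0.7) (z := 111 / 611)
    (l := -1.01889) (u := -1.01886)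
  have := log_bounds 4 (x := 0.03 + 0.07 * 0.7) (z := 33 / 283)
    (l := -2.53832) (u := -2.53829)
  have := log_bounds 1 (x := 0.8 * 0.7) (z := 3 / 53)
    (l := -0.57983) (u := -0.57980)
  refine ILM_le_of_endpoints hQ (r := 0.7) (a := 0.62) (u := 0.01) (v := 0.379) (a' := 0.82)
    (u' := 0.04) (v' := 0.562) (by norm_num) (by norm_num) (by norm_num) (by norm_num)
    (by norm_num) (by constructor <;> norm_num) (by constructor <;> norm_num) ?_ ?_ h h'
  · unfold crossInfo
    linarith [negEntropy_at_0_62]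
  · unfold crossInfo
    linarith [negEntropy_at_0_82]

lemma ILM_le_of_mem_0_82_1 {Q : Fin 2 → ℝ} (hQ : ∑ x, Q x = 1) (h : 0.82 ≤ Q 1)
    (h' : Q 1 ≤ 1) : ILM Q ≤ 0.1369 := by
  have := log_bounds 4 (x := 1 - 0.92) (z := 7 / 57)
    (l := -2.52574) (u := -2.52571)
  have := log_bounds 1 (x := 0.92) (z := 21 / 71)
    (l := -0.08340) (u := -0.08337)
  have := log_bounds 3 (x := 0.97 - 0.87 * 0.92) (z := 223 / 1473)
    (l := -1.77433) (u := -1.77430)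
  have := log_bounds 4 (x := 0.03 + 0.07 * 0.92) (z := 319 / 1569)
    (l := -2.36023) (u := -2.36020)
  have := log_bounds 1 (x := 0.8 * 0.92) (z := 59 / 309)
    (l := -0.30654) (u := -0.30651)
  refine ILM_le_of_endpoints hQ (r := 0.92) (a := 0.82) (u := 0.04) (v := 0.562) (a' := 1)
    (u' := 0.1) (v' := 0.8) (by norm_num) (by norm_num) (by norm_num) (by norm_num)
    (by norm_num) (by constructor <;> norm_num) (by constructor <;> norm_num) ?_ ?_ h h'
  · unfold crossInfo
    linarith [negEntropy_at_0_82]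
  · unfold crossInfo
    linarith [negEntropy_at_1]
lemma mul_mul_log_mul {k : ℝ} (hk : 0 < k) (a : ℝ) :
    k * a * log (k * a) = k * (a * log a) + a * (k * log k) := by
  rcases eq_or_ne a 0 with rfl | ha
  · simp
  · rw [log_mul hk.ne' ha]
    ring

/-- The mutual information for the choice `u = 0`, `v = 0.57458 * a`. -/
noncomputable def extremalInfo (a : ℝ) : ℝ :=
  (0.97 - 1.29542 * a) * log (0.97 - 1.29542 * a) - (0.97 - 0.87 * a) * log (0.97 - 0.87 * a)
    - (1 - a) * log (1 - a) - 0.57458 * (a * log a)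
    + a * ((0.8 - 0.57458) * log (0.8 - 0.57458) + (1 - 0.57458) * log (1 - 0.57458)
      + 0.57458 * log 0.57458 - 0.8 * log 0.8)

lemma ILM_le_extremalInfo {Q : Fin 2 → ℝ} (hQ : ∑ x, Q x = 1) (h0 : 0 ≤ Q 1) (h1 : Q 1 ≤ 0.44) :
    ILM Q ≤ extremalInfo (Q 1) := by
  have hadm : Admissible (Q 1) 0 (0.57458 * Q 1) := by constructor <;> linarith
  refine (ILM_le_of_admissible hQ hadm).trans_eq ?_
  have e1 := mul_mul_log_mul (k := 0.8 - 0.57458) (by norm_num) (Q 1)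
  have e2 := mul_mul_log_mul (k := 1 - 0.57458) (by norm_num) (Q 1)
  have e3 := mul_mul_log_mul (k := 0.57458) (by norm_num) (Q 1)
  have e4 := mul_mul_log_mul (k := 0.8) (by norm_num) (Q 1)
  unfold negEntropy extremalInfo
  rw [show 0.97 - 0.87 * Q 1 - (Q 1 - 0 - 0.57458 * Q 1) = 0.97 - 1.29542 * Q 1 by ring,
    show 0.8 * Q 1 - 0.57458 * Q 1 = (0.8 - 0.57458) * Q 1 by ring,
    show Q 1 - 0 - 0.57458 * Q 1 = (1 - 0.57458) * Q 1 by ring, sub_zero, e1, e2, e3, e4]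
  ring

/-- The derivative of `extremalInfo`. -/
noncomputable def extremalInfoDeriv (a : ℝ) : ℝ :=
  -1.29542 * (log (0.97 - 1.29542 * a) + 1) + 0.87 * (log (0.97 - 0.87 * a) + 1)
    + (log (1 - a) + 1) - 0.57458 * (log a + 1)
    + ((0.8 - 0.57458) * log (0.8 - 0.57458) + (1 - 0.57458) * log (1 - 0.57458)
      + 0.57458 * log 0.57458 - 0.8 * log 0.8)

lemma hasDerivAt_const_sub_mul (c k a : ℝ) : HasDerivAt (fun x ↦ c - k * x) (-k) a := by
  simpa using ((hasDerivAt_id a).const_mul k).const_sub c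

lemma hasDerivAt_extremalInfo {a : ℝ} (h0 : 0 < a) (h1 : a < 0.44) :
    HasDerivAt extremalInfo (extremalInfoDeriv a) a := by
  have d1 := (hasDerivAt_mul_log (x := 0.97 - 1.29542 * a) (by linarith)).comp a
    (hasDerivAt_const_sub_mul 0.97 1.29542 a)
  have d2 := (hasDerivAt_mul_log (x := 0.97 - 0.87 * a) (by linarith)).comp a
    (hasDerivAt_const_sub_mul 0.97 0.87 a)
  have d3 := (hasDerivAt_mul_log (x := 1 - a) (by linarith)).comp a
    ((hasDerivAt_id a).const_sub 1)
  have d4 := (hasDerivAt_mul_log h0.ne').const_mul 0.57458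
  have d5 := (hasDerivAt_id a).mul_const
    ((0.8 - 0.57458) * log (0.8 - 0.57458) + (1 - 0.57458) * log (1 - 0.57458)
      + 0.57458 * log 0.57458 - 0.8 * log 0.8)
  refine ((((d1.sub d2).sub d3).sub d4).add d5).congr_deriv ?_
  unfold extremalInfoDeriv
  ring

lemma hasDerivAt_extremalInfoDeriv {a : ℝ} (h0 : 0 < a) (h1 : a < 0.44) :
    HasDerivAt extremalInfoDeriv (1.29542 ^ 2 / (0.97 - 1.29542 * a)
      - 0.87 ^ 2 / (0.97 - 0.87 * a) - 1 / (1 - a) - 0.57458 / a) a := by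
  have d1 := (((hasDerivAt_const_sub_mul 0.97 1.29542 a).log (by linarith)).add_const 1).const_mul
    (-1.29542)
  have d2 := (((hasDerivAt_const_sub_mul 0.97 0.87 a).log (by linarith)).add_const 1).const_mul 0.87
  have d3 := (((hasDerivAt_id a).const_sub 1).log (by simp; linarith)).add_const 1
  have d4 := ((hasDerivAt_log h0.ne').add_const 1).const_mul 0.57458
  refine ((((d1.add d2).add d3).sub d4).add_const _).congr_deriv ?_
  simp only [id]
  ring

lemma concaveOn_extremalInfo : ConcaveOn ℝ (Set.Icc 0 0.44) extremalInfo := by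
  have hint : interior (Set.Icc (0 : ℝ) 0.44) = Set.Ioo 0 0.44 := interior_Icc
  refine concaveOn_of_hasDerivWithinAt2_nonpos (convex_Icc _ _) ?_
    (fun x hx ↦ (hasDerivAt_extremalInfo (hint ▸ hx).1 (hint ▸ hx).2).hasDerivWithinAt)
    (fun x hx ↦ (hasDerivAt_extremalInfoDeriv (hint ▸ hx).1 (hint ▸ hx).2).hasDerivWithinAt) ?_
  · have hc : ∀ c k : ℝ, Continuous fun a : ℝ ↦ (c - k * a) * log (c - k * a) := fun c k ↦
      continuous_mul_log.comp (by fun_prop)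
    have h1 : Continuous fun a : ℝ ↦ (1 - a) * log (1 - a) :=
      continuous_mul_log.comp (by fun_prop)
    exact (((((hc _ _).sub (hc _ _)).sub h1).sub (continuous_const.mul continuous_mul_log)).add
      (continuous_id.mul continuous_const)).continuousOn
  · intro x hx
    rw [hint] at hx
    obtain ⟨h0, h1⟩ := hx
    have p1 : 0 < 0.97 - 1.29542 * x := by linarith
    have p2 : 0 < 0.97 - 0.87 * x := by linarith
    have p3 : 0 < 1 - x := by linarith
    have common : ∀ {A B C : ℝ}, 0 < A → 0 < B → 0 < C →
        1.29542 ^ 2 / A - 0.87 ^ 2 / B - 1 / C - 0.57458 / x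
          = -((0.87 ^ 2 * A * C * x + B * A * x + 0.57458 * A * B * C - 1.29542 ^ 2 * B * C * x)
            / (A * B * C * x)) := by
      intro A B C hA hB hC
      field_simp
      ring
    rw [common p1 p2 p3, neg_nonpos]
    refine div_nonneg ?_ (by positivity)
    have p4 : 0 < 0.44 - x := by linarith
    nlinarith [mul_pos h0 p4, mul_pos (mul_pos h0 p4) h0, mul_pos (mul_pos h0 p4) p4]

lemma extremalInfo_le {a : ℝ} (h0 : 0 ≤ a) (h1 : a ≤ 0.44) : extremalInfo a ≤ 0.1369 := by
  have := log_bounds 1 (x := 0.97 - 1.29542 * 0.24418) (z := 384210861 / 2884210861)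
    (l := -0.42513073) (u := -0.42513066)
  have := log_bounds 1 (x := 0.97 - 0.87 * 0.24418) (z := 1287817 / 6287817)
    (l := -0.27764808) (u := -0.27764801)
  have := log_bounds 1 (x := 1 - 0.24418) (z := 12791 / 62791)
    (l := -0.27995206) (u := -0.27995199)
  have := log_bounds 3 (x := 0.24418) (z := 5959 / 18459)
    (l := -1.40984966) (u := -1.40984959)
  have := log_bounds 1 (x := 0.57458) (z := 3729 / 53729)
    (l := -0.55411597) (u := -0.55411590)
  have := log_bounds 2 (x := 1 - 0.57458) (z := 8771 / 33771)
    (l := -0.85467840) (u := -0.85467833)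
  have := log_bounds 3 (x := 0.8 - 0.57458) (z := 5021 / 17521)
    (l := -1.48978999) (u := -1.48978992)
  have := log_bounds 1 (x := 0.8) (z := 3 / 13)
    (l := -0.22314359) (u := -0.22314352)
  have hd := hasDerivAt_extremalInfo (a := 0.24418) (by norm_num) (by norm_num)
  have hval : extremalInfo 0.24418 ≤ 0.136894 := by
    unfold extremalInfo
    linarith
  have hl : -0.00001 ≤ extremalInfoDeriv 0.24418 := by
    unfold extremalInfoDeriv
    linarith
  have hu : extremalInfoDeriv 0.24418 ≤ 0 := by
    unfold extremalInfoDeriv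
    linarith
  have hmem : (0.24418 : ℝ) ∈ Set.Icc (0 : ℝ) 0.44 := by constructor <;> norm_num
  have ha : a ∈ Set.Icc (0 : ℝ) 0.44 := ⟨h0, h1⟩
  rcases lt_trichotomy a 0.24418 with h | rfl | h
  · have hs := concaveOn_extremalInfo.le_slope_of_hasDerivAt ha hmem h hd
    rw [slope_def_field, le_div_iff₀ (by linarith)] at hs
    nlinarith
  · linarith
  · have hs := concaveOn_extremalInfo.slope_le_of_hasDerivAt hmem ha h hd
    rw [slope_def_field, div_le_iff₀ (by linarith)] at hs
    nlinarith

/-- For the counter-example channel and metric, the primal LM rate satisfies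
`I_LM(Q) ≤ 0.1369` for every input distribution `Q` on `{0,1}`. -/
theorem LM_rate_upper_bound :
    ∀ Q : Fin 2 → ℝ, (∀ x, 0 ≤ Q x) → (∑ x, Q x) = 1 → ILM Q ≤ 0.1369 := by
  intro Q hQ0 hQ
  have h1 : Q 1 ≤ 1 := by
    have := hQ0 0
    rw [Fin.sum_univ_two] at hQ
    linarith
  rcases le_total (Q 1) 0.44 with h | h
  · exact (ILM_le_extremalInfo hQ (hQ0 1) h).trans (extremalInfo_le (hQ0 1) h)
  rcases le_total (Q 1) 0.62 with h' | h'
  · exact ILM_le_of_mem_0_44_0_62 hQ h h'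
  rcases le_total (Q 1) 0.82 with h'' | h''
  · exact ILM_le_of_mem_0_62_0_82 hQ h' h''
  · exact ILM_le_of_mem_0_82_1 hQ h'' h1
end

section
/- Consider the second-order product of the specific channel and metric given below, and the superposition-coding input distribution Q_{UX} built from Q = (0.749, 0.251) as specified. With s = 9.4261226 and a : U × X² → ℝ given by a(0,(0,0)) = 0.4817048, a(0,(0,1)) = a(0,(1,0)) = −0.2408524, a(0,(1,1)) = 0, and a(1,x) = 0 for all x, the dual superposition-coding R₁ objective satisfies Σ_{u,x,y} Q_U(u) Q_{X|U}(x|u) W²(y|x) log( q²(x,y)^s e^{a(u,x)} / Σ_{x̄} Q_{X|U}(x̄|u) q²(x̄,y)^s e^{a(u,x̄)} ) ≥ 0.2403966. -/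
open scoped BigOperators

/-- The second-order product channel `W²((y₁,y₂)|(x₁,x₂))`. -/
noncomputable def W2 (x : Fin 2 × Fin 2) (y : Fin 3 × Fin 3) : ℝ := W x.1 y.1 * W x.2 y.2

/-- The second-order product metric `q²((x₁,x₂),(y₁,y₂))`. -/
noncomputable def q2 (x : Fin 2 × Fin 2) (y : Fin 3 × Fin 3) : ℝ := q x.1 y.1 * q x.2 y.2

/-- The auxiliary distribution `Q_U` built from `Q = (0.749, 0.251)`. -/
noncomputable def QU : Fin 2 → ℝ := ![1 - (0.251 : ℝ) ^ 2, (0.251 : ℝ) ^ 2]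

/-- The conditional input distribution `Q_{X|U}` built from `Q = (0.749, 0.251)`:
`Q_{X|U}(·|0) = (Q₀², Q₀Q₁, Q₀Q₁, 0)/(1 − Q₁²)` and `Q_{X|U}(·|1) = (0,0,0,1)`,
inputs ordered `(0,0), (0,1), (1,0), (1,1)`. -/
noncomputable def QXU : Fin 2 → Fin 2 × Fin 2 → ℝ := fun u x =>
  if u = 0 then
    (if x = (0, 0) then (0.749 : ℝ) ^ 2
     else if x = (1, 1) then 0
     else (0.749 : ℝ) * 0.251) / (1 - (0.251 : ℝ) ^ 2)
  else if x = (1, 1) then 1 else 0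

/-- The function `a(u,x)` used in the dual `R₁` bound. -/
noncomputable def aR1 : Fin 2 → Fin 2 × Fin 2 → ℝ := fun u x =>
  if u = 0 then
    (if x = (0, 0) then 0.4817048
     else if x = (1, 1) then 0
     else -0.2408524)
  else 0

open Finset in
/-- An upper bound for `exp` from the Taylor polynomial of degree `13` at `x / 4`. -/
lemma exp_le_taylor_quarter_pow {x : ℝ} (h0 : 0 ≤ x) (h4 : x ≤ 4) :
    Real.exp x ≤ ((∑ m ∈ range 14, (x / 4) ^ m / (m.factorial : ℝ)) +
      (x / 4) ^ 14 * (14 + 1) / ((14).factorial * 14)) ^ 4 := by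
  have h := Real.exp_bound' (x := x / 4) (by linarith) (by linarith) (n := 14) (by norm_num)
  calc Real.exp x = Real.exp (x / 4) ^ 4 := by
        rw [← Real.exp_nat_mul]
        congr 1
        push_cast
        ring
    _ ≤ _ := by
        gcongr
        exact_mod_cast h

open Finset in
/-- A lower bound for `exp` from the Taylor polynomial of degree `17` at `x / 4`. -/
lemma taylor_quarter_pow_le_exp {x : ℝ} (h0 : 0 ≤ x) :
    (∑ m ∈ range 18, (x / 4) ^ m / (m.factorial : ℝ)) ^ 4 ≤ Real.exp x := by
  have h := Real.sum_le_exp_of_nonneg (x := x / 4) (by linarith) 18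
  calc _ ≤ Real.exp (x / 4) ^ 4 := by gcongr
    _ = Real.exp x := by
        rw [← Real.exp_nat_mul]
        congr 1
        push_cast
        ring

/-- To bound `log y` from above it suffices to compare `y` with a Taylor polynomial. -/
lemma log_le_of_le_taylor_quarter_pow {x y : ℝ} (hy : 0 < y) (h0 : 0 ≤ x)
    (h : y ≤ (∑ m ∈ Finset.range 18, (x / 4) ^ m / (m.factorial : ℝ)) ^ 4) :
    Real.log y ≤ x :=
  (Real.log_le_iff_le_exp hy).2 (h.trans (taylor_quarter_pow_le_exp h0))

lemma log_136_lower : (0.30748469974 : ℝ) ≤ Real.log 1.36 := by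
  rw [Real.le_log_iff_exp_le (by norm_num)]
  refine (exp_le_taylor_quarter_pow (by norm_num) (by norm_num)).trans ?_
  norm_num [Finset.sum_range_succ, Nat.factorial]

lemma log_136_upper : Real.log 1.36 ≤ (0.30748469975 : ℝ) := by
  refine log_le_of_le_taylor_quarter_pow (by norm_num) (by norm_num) ?_
  norm_num [Finset.sum_range_succ, Nat.factorial]

lemma exp_a_diag_upper : Real.exp 0.4817048 ≤ (1.6188318358 : ℝ) := by
  refine (exp_le_taylor_quarter_pow (by norm_num) (by norm_num)).trans ?_
  norm_num [Finset.sum_range_succ, Nat.factorial]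

lemma exp_a_offdiag_upper : Real.exp (-0.2408524) ≤ (0.7859576253 : ℝ) := by
  rw [Real.exp_neg]
  refine inv_le_of_inv_le₀ (by norm_num) ?_
  refine le_trans ?_ (taylor_quarter_pow_le_exp (by norm_num))
  norm_num [Finset.sum_range_succ, Nat.factorial]

lemma rpow_136_upper : (1.36 : ℝ) ^ (9.4261226 : ℝ) ≤ 18.144880915 := by
  rw [Real.rpow_def_of_pos (by norm_num)]
  have h : Real.log 1.36 * 9.4261226 ≤ 2.8983884775 := by
    linarith [log_136_upper]
  refine (Real.exp_le_exp.2 h).trans ?_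
  refine (exp_le_taylor_quarter_pow (by norm_num) (by norm_num)).trans ?_
  norm_num [Finset.sum_range_succ, Nat.factorial]

lemma rpow_half_upper : (0.5 : ℝ) ^ (9.4261226 : ℝ) ≤ 0.0014536321 := by
  rw [Real.rpow_def_of_pos (by norm_num), show (0.5 : ℝ) = 2⁻¹ by norm_num, Real.log_inv]
  have h : -Real.log 2 * 9.4261226 ≤ -6.5336903 := by
    linarith [Real.log_two_gt_d9]
  refine (Real.exp_le_exp.2 h).trans ?_
  rw [Real.exp_neg]
  refine inv_le_of_inv_le₀ (by norm_num) ?_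
  refine le_trans ?_ (taylor_quarter_pow_le_exp (by norm_num))
  norm_num [Finset.sum_range_succ, Nat.factorial]

/-- The denominator inside the logarithm of the dual `R₁` objective. -/
noncomputable def dualDenom (u : Fin 2) (y : Fin 3 × Fin 3) : ℝ :=
  ∑ x' : Fin 2 × Fin 2, QXU u x' * q2 x' y ^ (9.4261226 : ℝ) * Real.exp (aR1 u x')

lemma q_pos (x : Fin 2) (y : Fin 3) : 0 < q x y := by
  fin_cases x <;> fin_cases y <;> norm_num [q]

lemma q2_pos (x : Fin 2 × Fin 2) (y : Fin 3 × Fin 3) : 0 < q2 x y :=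
  mul_pos (q_pos _ _) (q_pos _ _)

lemma q2_rpow (x : Fin 2 × Fin 2) (y : Fin 3 × Fin 3) (s : ℝ) :
    q2 x y ^ s = q x.1 y.1 ^ s * q x.2 y.2 ^ s :=
  Real.mul_rpow (q_pos _ _).le (q_pos _ _).le

lemma log_q2 (x : Fin 2 × Fin 2) (y : Fin 3 × Fin 3) :
    Real.log (q2 x y) = Real.log (q x.1 y.1) + Real.log (q x.2 y.2) :=
  Real.log_mul (q_pos _ _).ne' (q_pos _ _).ne'

lemma dualDenom_zero (y : Fin 3 × Fin 3) :
    dualDenom 0 y = (0.749 ^ 2 * Real.exp 0.4817048 +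
      0.749 * 0.251 * Real.exp (-0.2408524) *
        (q 1 y.1 ^ (9.4261226 : ℝ) + q 1 y.2 ^ (9.4261226 : ℝ))) / (1 - 0.251 ^ 2) := by
  have h (j : Fin 3) : q 0 j = 1 := by fin_cases j <;> simp [q]
  simp only [dualDenom, q2_rpow, Fintype.sum_prod_type, Fin.sum_univ_two, h, Real.one_rpow]
  simp [QXU, aR1]
  ring

lemma dualDenom_one (y : Fin 3 × Fin 3) :
    dualDenom 1 y = q2 (1, 1) y ^ (9.4261226 : ℝ) := by
  simp [dualDenom, QXU, aR1]

lemma dualDenom_zero_pos (y : Fin 3 × Fin 3) : 0 < dualDenom 0 y := by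
  rw [dualDenom_zero]
  have h1 := Real.rpow_pos_of_pos (q_pos 1 y.1) 9.4261226
  have h2 := Real.rpow_pos_of_pos (q_pos 1 y.2) 9.4261226
  refine div_pos ?_ (by norm_num)
  positivity

lemma dualDenom_zero_le (y : Fin 3 × Fin 3) {r₁ r₂ : ℝ}
    (h₁ : q 1 y.1 ^ (9.4261226 : ℝ) ≤ r₁) (h₂ : q 1 y.2 ^ (9.4261226 : ℝ) ≤ r₂) :
    dualDenom 0 y ≤ (0.749 ^ 2 * 1.6188318358 +
      0.749 * 0.251 * 0.7859576253 * (r₁ + r₂)) / (1 - 0.251 ^ 2) := by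
  rw [dualDenom_zero]
  have := exp_a_diag_upper
  have := exp_a_offdiag_upper
  have h0 : (0 : ℝ) ≤ 1 - 0.251 ^ 2 := by norm_num
  have := (Real.rpow_pos_of_pos (q_pos 1 y.1) 9.4261226).le
  have := (Real.rpow_pos_of_pos (q_pos 1 y.2) 9.4261226).le
  gcongr

lemma q_one_zero_rpow_le : q 1 0 ^ (9.4261226 : ℝ) ≤ 1 := by
  simp [q]

lemma q_one_one_rpow_le : q 1 1 ^ (9.4261226 : ℝ) ≤ 0.0014536321 := by
  simpa [q] using rpow_half_upper

lemma q_one_two_rpow_le : q 1 2 ^ (9.4261226 : ℝ) ≤ 18.144880915 := by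
  simpa [q] using rpow_136_upper

lemma dualDenom_zero_symm (i j : Fin 3) : dualDenom 0 (i, j) = dualDenom 0 (j, i) := by
  simp only [dualDenom_zero, add_comm]

lemma log_dualDenom_zero_zero : Real.log (dualDenom 0 (0, 0)) ≤ 0.250460562 := by
  refine log_le_of_le_taylor_quarter_pow (dualDenom_zero_pos _) (by norm_num)
    ((dualDenom_zero_le _ q_one_zero_rpow_le
      q_one_zero_rpow_le).trans ?_)
  norm_num [Finset.sum_range_succ, Nat.factorial]

lemma log_dualDenom_zero_one : Real.log (dualDenom 0 (0, 1)) ≤ 0.119694114 := by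
  refine log_le_of_le_taylor_quarter_pow (dualDenom_zero_pos _) (by norm_num)
    ((dualDenom_zero_le _ q_one_zero_rpow_le
      q_one_one_rpow_le).trans ?_)
  norm_num [Finset.sum_range_succ, Nat.factorial]

lemma log_dualDenom_zero_two : Real.log (dualDenom 0 (0, 2)) ≤ 1.383356076 := by
  refine log_le_of_le_taylor_quarter_pow (dualDenom_zero_pos _) (by norm_num)
    ((dualDenom_zero_le _ q_one_zero_rpow_le
      q_one_two_rpow_le).trans ?_)
  norm_num [Finset.sum_range_succ, Nat.factorial]

lemma log_dualDenom_one_two : Real.log (dualDenom 0 (1, 2)) ≤ 1.343073451 := by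
  refine log_le_of_le_taylor_quarter_pow (dualDenom_zero_pos _) (by norm_num)
    ((dualDenom_zero_le _ q_one_one_rpow_le
      q_one_two_rpow_le).trans ?_)
  norm_num [Finset.sum_range_succ, Nat.factorial]

lemma log_dualDenom_one_one : Real.log (dualDenom 0 (1, 1)) ≤ -0.030781824 := by
  rw [Real.log_le_iff_le_exp (dualDenom_zero_pos _), Real.exp_neg]
  refine (dualDenom_zero_le _ q_one_one_rpow_le
    q_one_one_rpow_le).trans ?_
  refine le_inv_of_le_inv₀ (Real.exp_pos _)
    ((exp_le_taylor_quarter_pow (by norm_num) (by norm_num)).trans ?_)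
  norm_num [Finset.sum_range_succ, Nat.factorial]

lemma log_ratio_zero (x : Fin 2 × Fin 2) (y : Fin 3 × Fin 3) :
    Real.log (q2 x y ^ (9.4261226 : ℝ) * Real.exp (aR1 0 x) / dualDenom 0 y) =
      9.4261226 * (Real.log (q x.1 y.1) + Real.log (q x.2 y.2)) + aR1 0 x -
        Real.log (dualDenom 0 y) := by
  have h := Real.rpow_pos_of_pos (q2_pos x y) 9.4261226
  rw [Real.log_div (mul_pos h (Real.exp_pos _)).ne' (dualDenom_zero_pos y).ne',
    Real.log_mul h.ne' (Real.exp_pos _).ne', Real.log_exp, Real.log_rpow (q2_pos x y), log_q2]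

/-- The terms of the objective with `u = 1` vanish. -/
lemma objective_one_term (x : Fin 2 × Fin 2) (y : Fin 3 × Fin 3) :
    QU 1 * QXU 1 x * W2 x y *
      Real.log (q2 x y ^ (9.4261226 : ℝ) * Real.exp (aR1 1 x) / dualDenom 1 y) = 0 := by
  by_cases hx : x = (1, 1)
  · subst hx
    have h := Real.rpow_pos_of_pos (q2_pos (1, 1) y) 9.4261226
    rw [dualDenom_one]
    simp [aR1, div_self h.ne']
  · simp [QXU, hx]

/-- With `s = 9.4261226` and the given `a`, the dual superposition-coding `R₁` objective
for the second-order product channel is at least `0.2403966`. -/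
theorem SC_R1_dual_bound :
    (∑ u : Fin 2, ∑ x : Fin 2 × Fin 2, ∑ y : Fin 3 × Fin 3,
      QU u * QXU u x * W2 x y *
        Real.log (q2 x y ^ (9.4261226 : ℝ) * Real.exp (aR1 u x) /
          (∑ x' : Fin 2 × Fin 2,
            QXU u x' * q2 x' y ^ (9.4261226 : ℝ) * Real.exp (aR1 u x'))))
    ≥ 0.2403966 := by
  change (∑ u : Fin 2, ∑ x : Fin 2 × Fin 2, ∑ y : Fin 3 × Fin 3,
      QU u * QXU u x * W2 x y *
        Real.log (q2 x y ^ (9.4261226 : ℝ) * Real.exp (aR1 u x) / dualDenom u y)) ≥ 0.2403966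
  simp only [Fin.sum_univ_two (f := fun u : Fin 2 => ∑ x : Fin 2 × Fin 2, _),
    objective_one_term, Finset.sum_const_zero, add_zero, log_ratio_zero]
  simp only [Fintype.sum_prod_type, Fin.sum_univ_two, Fin.sum_univ_three]
  rw [dualDenom_zero_symm 1 0, dualDenom_zero_symm 2 0, dualDenom_zero_symm 2 1]
  have h00 := log_dualDenom_zero_zero
  have h01 := log_dualDenom_zero_one
  have h02 := log_dualDenom_zero_two
  have h11 := log_dualDenom_one_one
  have h12 := log_dualDenom_one_two
  have hp := log_136_lower
  have h2 := Real.log_two_lt_d9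
  have hq0 (j : Fin 3) : Real.log (q 0 j) = 0 := by fin_cases j <;> simp [q]
  have hq10 : Real.log (q 1 0) = 0 := by simp [q]
  have hq11 : Real.log (q 1 1) = -Real.log 2 := by
    rw [← Real.log_inv]
    norm_num [q]
  have hq12 : Real.log (q 1 2) = Real.log 1.36 := by simp [q]
  have hW02 : W 0 2 = 0 := by simp [W]
  have hW12 : W 1 2 = 0.8 := by simp [W]
  simp only [W2, hW02, hW12, hq0, hq10, hq11, hq12]
  generalize Real.log 1.36 = p at hp ⊢
  norm_num [QU, QXU, W, aR1]
  linarith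
end

section
/- Let Q' = (Q'₀, Q'₁) and Q = (Q₀, Q₁) be probability vectors on {0,1} with min{Q'₀, Q'₁} ≥ Q_min and min{Q₀, Q₁} ≥ Q_min for some Q_min > 0, and suppose |Q₀ − Q'₀| ≤ δ. Then |H(Q') − H(Q)| ≤ δ log( (1 − Q_min) / Q_min ), where H(p₀, p₁) = −p₀ log p₀ − p₁ log p₁. -/
theorem Real.abs_binEntropy_sub_le {m x y : ℝ} (hm : 0 < m)
    (hx : x ∈ Set.Icc m (1 - m)) (hy : y ∈ Set.Icc m (1 - m)) :
    |Real.binEntropy y - Real.binEntropy x| ≤ Real.log ((1 - m) / m) * |y - x| := by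
  refine Convex.norm_image_sub_le_of_norm_deriv_le (f := Real.binEntropy) ?_ ?_
    (convex_Icc m (1 - m)) hx hy
  · intro z hz
    have hz0 : 0 < z := hm.trans_le hz.1
    have hz1 : z < 1 := by linarith [hz.2]
    exact Real.differentiableAt_binEntropy hz0.ne' hz1.ne
  · intro z hz
    have hz0 : 0 < z := hm.trans_le hz.1
    have hz1 : 0 < 1 - z := by linarith [hz.2]
    have hm1 : 0 < 1 - m := hz0.trans_le hz.2
    have h₁ := Real.log_le_log hm hz.1
    have h₂ := Real.log_le_log hz0 hz.2
    have h₃ := Real.log_le_log hm (show m ≤ 1 - z by linarith [hz.2])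
    have h₄ := Real.log_le_log hz1 (show 1 - z ≤ 1 - m by linarith [hz.1])
    rw [Real.deriv_binEntropy, Real.norm_eq_abs, Real.log_div hm1.ne' hm.ne', abs_le]
    constructor <;> linarith

/-- Continuity of the binary entropy function for probability vectors on `{0,1}`
bounded away from the deterministic distributions (Lemma 1 of the paper):
if `min{Q'₀,Q'₁} ≥ Q_min > 0`, `min{Q₀,Q₁} ≥ Q_min`, and `|Q₀ − Q'₀| ≤ δ`, then
`|H(Q') − H(Q)| ≤ δ log((1 − Q_min)/Q_min)`. -/
theorem binary_entropy_continuity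
    (Qmin δ : ℝ) (hQmin : 0 < Qmin)
    (Q0' Q1' Q0 Q1 : ℝ)
    (hQ'sum : Q0' + Q1' = 1) (hQsum : Q0 + Q1 = 1)
    (hQ' : Qmin ≤ min Q0' Q1') (hQ : Qmin ≤ min Q0 Q1)
    (hδ : |Q0 - Q0'| ≤ δ) :
    |(-(Q0' * Real.log Q0') - Q1' * Real.log Q1') -
      (-(Q0 * Real.log Q0) - Q1 * Real.log Q1)| ≤
      δ * Real.log ((1 - Qmin) / Qmin) := by
  obtain rfl : Q1' = 1 - Q0' := by linarith
  obtain rfl : Q1 = 1 - Q0 := by linarith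
  obtain ⟨h₁, h₂⟩ := le_min_iff.1 hQ'
  obtain ⟨h₃, h₄⟩ := le_min_iff.1 hQ
  have key := Real.abs_binEntropy_sub_le hQmin (x := Q0) (y := Q0')
    ⟨h₃, by linarith⟩ ⟨h₁, by linarith⟩
  have hlog : 0 ≤ Real.log ((1 - Qmin) / Qmin) :=
    Real.log_nonneg ((one_le_div hQmin).2 (by linarith))
  rw [abs_sub_comm] at hδ
  simp only [Real.binEntropy_eq_negMulLog_add_negMulLog_one_sub, Real.negMulLog, neg_mul,
    ← sub_eq_add_neg] at key
  rw [mul_comm δ]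
  exact key.trans (mul_le_mul_of_nonneg_left hδ hlog)
end

section
/- Let W be a discrete memoryless channel from X = {0,1} to a finite output alphabet Y and q : X×Y → [0,∞) a decoding metric. Let Q' and Q be input distributions on {0,1} with min{Q'₀, Q'₁} ≥ Q_min and min{Q₀, Q₁} ≥ Q_min for some Q_min > 0, and suppose |Q₀ − Q'₀| ≤ δ. Then the dual LM rate satisfies I_LM(Q) ≥ I_LM(Q') − δ log( (1 − Q_min)/Q_min ) − δ (log 2)/Q_min. -/
open scoped BigOperators

/-- The dual LM rate for a binary-input DMC `W : {0,1} → P(Y)`, decoding metric `q`,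
and input distribution `Q`:
`I_LM(Q) = sup_{s ≥ 0, a} Σ_{x,y} Q(x) W(y|x) log( q(x,y)^s e^{a(x)} / Σ_{x̄} Q(x̄) q(x̄,y)^s e^{a(x̄)} )`. -/
noncomputable def ILMdual {Y : Type*} [Fintype Y]
    (W : Fin 2 → Y → ℝ) (q : Fin 2 → Y → ℝ) (Q : Fin 2 → ℝ) : ℝ :=
  sSup { r : ℝ | ∃ s : ℝ, 0 ≤ s ∧ ∃ a : Fin 2 → ℝ,
    r = ∑ x, ∑ y, Q x * W x y *
      Real.log (q x y ^ s * Real.exp (a x) /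
        (∑ x', Q x' * q x' y ^ s * Real.exp (a x'))) }

/-- `Σ_y W(y|x) log( w(x,y) g(x) / Σ_x̄ g(x̄) w(x̄,y) )`, the rate contribution of the input `x`
expressed through the tilted weights `g(x) = Q(x) e^{a(x)}`. -/
noncomputable def posteriorLog {Y : Type*} [Fintype Y] (W w : Fin 2 → Y → ℝ) (g : Fin 2 → ℝ)
    (x : Fin 2) : ℝ :=
  ∑ y, W x y * Real.log (w x y * g x / ∑ x', w x' y * g x')

open Classical in
/-- The conditional probability, given the input `x`, that the metric weight is nonzero. -/
noncomputable def supportMass {Y : Type*} [Fintype Y] (W w : Fin 2 → Y → ℝ) (x : Fin 2) : ℝ :=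
  ∑ y, W x y * if w x y = 0 then 0 else 1

section

variable {Y : Type*} [Fintype Y] {W w : Fin 2 → Y → ℝ} {g : Fin 2 → ℝ}

lemma posteriorLog_nonpos (hW : ∀ x y, 0 ≤ W x y) (hw : ∀ x y, 0 ≤ w x y)
    (hg : ∀ x, 0 < g x) (x : Fin 2) : posteriorLog W w g x ≤ 0 := by
  refine Finset.sum_nonpos fun y _ => mul_nonpos_of_nonneg_of_nonpos (hW x y) ?_
  have hnn : ∀ x', 0 ≤ w x' y * g x' := fun x' => mul_nonneg (hw x' y) (hg x').le
  exact Real.log_nonpos (div_nonneg (hnn x) (Finset.sum_nonneg fun x' _ => hnn x'))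
    (div_le_one_of_le₀ (Finset.single_le_sum (fun x' _ => hnn x') (Finset.mem_univ x))
      (Finset.sum_nonneg fun x' _ => hnn x'))

lemma supportMass_nonneg (hW : ∀ x y, 0 ≤ W x y) (x : Fin 2) : 0 ≤ supportMass W w x := by
  refine Finset.sum_nonneg fun y _ => mul_nonneg (hW x y) ?_
  split_ifs <;> norm_num

lemma supportMass_le_one (hW : ∀ x y, 0 ≤ W x y) (hW1 : ∀ x, ∑ y, W x y = 1) (x : Fin 2) :
    supportMass W w x ≤ 1 := by
  rw [← hW1 x]
  refine Finset.sum_le_sum fun y _ => mul_le_of_le_one_right (hW x y) ?_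
  split_ifs <;> norm_num

lemma sum_rate_eq {Q a : Fin 2 → ℝ} (hw : ∀ x y, 0 ≤ w x y) (hQ : ∀ x, 0 < Q x) :
    ∑ x, ∑ y, Q x * W x y *
        Real.log (w x y * Real.exp (a x) / (∑ x', Q x' * w x' y * Real.exp (a x'))) =
      ∑ x, Q x * (posteriorLog W w (fun x => Q x * Real.exp (a x)) x
        - supportMass W w x * Real.log (Q x)) := by
  refine Finset.sum_congr rfl fun x _ => ?_
  rw [posteriorLog, supportMass, Finset.sum_mul, ← Finset.sum_sub_distrib, Finset.mul_sum]
  refine Finset.sum_congr rfl fun y _ => ?_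
  have hD : ∑ x', Q x' * w x' y * Real.exp (a x') = ∑ x', w x' y * (Q x' * Real.exp (a x')) :=
    Finset.sum_congr rfl fun x' _ => by ring
  rw [hD]
  by_cases h : w x y = 0
  · simp [h]
  · have hnn : ∀ x', 0 ≤ w x' y * (Q x' * Real.exp (a x')) := fun x' =>
      mul_nonneg (hw x' y) (mul_pos (hQ x') (Real.exp_pos _)).le
    have hpos : 0 < w x y * (Q x * Real.exp (a x)) :=
      mul_pos (lt_of_le_of_ne (hw x y) (Ne.symm h)) (mul_pos (hQ x) (Real.exp_pos _))
    have hDpos := hpos.trans_le (Finset.single_le_sum (fun x' _ => hnn x') (Finset.mem_univ x))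
    have hlog : w x y * (Q x * Real.exp (a x)) / ∑ x', w x' y * (Q x' * Real.exp (a x')) =
        Q x * (w x y * Real.exp (a x) / ∑ x', w x' y * (Q x' * Real.exp (a x'))) := by ring
    rw [hlog, Real.log_mul (hQ x).ne'
      (div_pos (mul_pos (lt_of_le_of_ne (hw x y) (Ne.symm h)) (Real.exp_pos _)) hDpos).ne']
    simp only [h, if_false]
    ring

end

lemma bddAbove_rates {Y : Type*} [Fintype Y] {W q : Fin 2 → Y → ℝ} {Q : Fin 2 → ℝ}
    (hW : ∀ x y, 0 ≤ W x y) (hW1 : ∀ x, ∑ y, W x y = 1) (hq : ∀ x y, 0 ≤ q x y)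
    (hQ : ∀ x, 0 < Q x) :
    BddAbove { r : ℝ | ∃ s : ℝ, 0 ≤ s ∧ ∃ a : Fin 2 → ℝ,
      r = ∑ x, ∑ y, Q x * W x y *
        Real.log (q x y ^ s * Real.exp (a x) /
          (∑ x', Q x' * q x' y ^ s * Real.exp (a x'))) } := by
  refine ⟨∑ x, Q x * |Real.log (Q x)|, ?_⟩
  rintro r ⟨s, -, a, rfl⟩
  have hw : ∀ x y, 0 ≤ q x y ^ s := fun x y => Real.rpow_nonneg (hq x y) s
  rw [sum_rate_eq (w := fun x y => q x y ^ s) hw hQ]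
  refine Finset.sum_le_sum fun x _ => mul_le_mul_of_nonneg_left ?_ (hQ x).le
  have hU := posteriorLog_nonpos hW hw (fun x => mul_pos (hQ x) (Real.exp_pos (a x))) x
  have h0 := supportMass_nonneg (w := fun x y => q x y ^ s) hW x
  have h1 := supportMass_le_one (w := fun x y => q x y ^ s) hW hW1 x
  have habs := mul_le_of_le_one_left (abs_nonneg (Real.log (Q x))) h1
  have hneg := mul_le_mul_of_nonneg_left (neg_abs_le (Real.log (Q x))) h0
  linarith

/-- Tangent-line bound for the concave function `t ↦ -t log t`. -/
lemma neg_mul_log_sub_ge {t u : ℝ} (ht : 0 < t) (hu : 0 < u) :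
    (-Real.log t - 1) * (t - u) ≤ u * Real.log u - t * Real.log t := by
  have h := mul_le_mul_of_nonneg_left (Real.log_le_sub_one_of_pos (div_pos ht hu)) hu.le
  rw [Real.log_div ht.ne' hu.ne'] at h
  have e : u * (t / u - 1) = t - u := by field_simp
  rw [e] at h
  linarith

lemma affine_nonneg_of_vertices {A B K c d : ℝ} (hc0 : 0 ≤ c) (hc1 : c ≤ 1) (hd0 : 0 ≤ d)
    (hd1 : d ≤ 1) (hK : 0 ≤ K) (hA : 0 ≤ A + K) (hB : 0 ≤ B + K) (hAB : 0 ≤ A + B + K) :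
    0 ≤ c * A + d * B + K := by
  have h1 := mul_nonneg (mul_nonneg hc0 hd0) hAB
  have h2 := mul_nonneg (mul_nonneg hc0 (sub_nonneg.2 hd1)) hA
  have h3 := mul_nonneg (mul_nonneg (sub_nonneg.2 hc1) hd0) hB
  have h4 := mul_nonneg (mul_nonneg (sub_nonneg.2 hc1) (sub_nonneg.2 hd1)) hK
  linarith

lemma rate_perturbation_of_le {m p₀ p₁ r₀ r₁ c₀ c₁ U₀ U₁ : ℝ} (hm : 0 < m)
    (hp₀ : m ≤ p₀) (hp₁ : m ≤ p₁) (hr₁ : m ≤ r₁) (hp : p₀ + p₁ = 1)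
    (hr : r₀ + r₁ = 1) (hpr : p₀ ≤ r₀) (hc₀ : 0 ≤ c₀) (hc₀' : c₀ ≤ 1) (hc₁ : 0 ≤ c₁)
    (hc₁' : c₁ ≤ 1) (hU₁ : U₁ ≤ 0)
    (hnn : 0 ≤ p₀ * (U₀ - c₀ * Real.log p₀) + p₁ * (U₁ - c₁ * Real.log p₁)) :
    p₀ * (U₀ - c₀ * Real.log p₀) + p₁ * (U₁ - c₁ * Real.log p₁)
        - (r₀ - p₀) * (Real.log ((1 - m) / m) + Real.log 2 / m) ≤
      r₀ * (U₀ - c₀ * Real.log r₀) + r₁ * (U₁ - c₁ * Real.log r₁) := by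
  have hp₀pos : 0 < p₀ := hm.trans_le hp₀
  have hp₁pos : 0 < p₁ := hm.trans_le hp₁
  have hr₀pos : 0 < r₀ := hp₀pos.trans_le hpr
  have hr₁pos : 0 < r₁ := hm.trans_le hr₁
  have hm2 : m ≤ 1 / 2 := by linarith
  have hlog2 : 1 / 2 < Real.log 2 := by linarith [Real.log_two_gt_d9]
  have hL : 2 * Real.log 2 ≤ Real.log 2 / m := by
    rw [le_div_iff₀ hm]; nlinarith
  rw [Real.log_div (by linarith) hm.ne']
  have lr₀ : Real.log r₀ ≤ Real.log (1 - m) := Real.log_le_log hr₀pos (by linarith)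
  have lr₁ : Real.log m ≤ Real.log r₁ := Real.log_le_log hm hr₁
  have lp₀ : Real.log m ≤ Real.log p₀ := Real.log_le_log hm hp₀
  have lm : Real.log m ≤ Real.log (1 - m) := Real.log_le_log hm (by linarith)
  have lm2 : -Real.log 2 ≤ Real.log (1 - m) := by
    rw [← Real.log_inv]; exact Real.log_le_log (by norm_num) (by linarith)
  have hent : -(Real.log 2 / m) ≤ Real.log p₀ + p₁ * Real.log p₁ / p₀ := by
    have h := Real.binEntropy_le_log_two (p := p₀)
    rw [Real.binEntropy, Real.log_inv, Real.log_inv, show 1 - p₀ = p₁ by linarith] at h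
    have e : Real.log p₀ + p₁ * Real.log p₁ / p₀
        = -((p₀ * -Real.log p₀ + p₁ * -Real.log p₁) / p₀) := by field_simp; ring
    rw [e]
    have := div_le_div₀ (by linarith) h hm hp₀
    linarith
  have hh : -1 ≤ p₁ * Real.log p₁ / p₀ := by
    rw [le_div_iff₀ hp₀pos]
    have h := neg_mul_log_sub_ge (t := 1) (u := p₁) one_pos hp₁pos
    simp only [Real.log_one] at h
    linarith
  have key := affine_nonneg_of_vertices (A := -Real.log r₀ - 1 + Real.log p₀)
    (B := 1 + Real.log r₁ + p₁ * Real.log p₁ / p₀)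
    (K := Real.log (1 - m) - Real.log m + Real.log 2 / m) hc₀ hc₀' hc₁ hc₁'
    (by linarith) (by linarith) (by linarith) (by linarith)
  have hU₀ : c₀ * Real.log p₀ + c₁ * (p₁ * Real.log p₁ / p₀) ≤ U₀ := by
    have e : c₀ * Real.log p₀ + c₁ * (p₁ * Real.log p₁ / p₀)
        = (p₀ * (c₀ * Real.log p₀) + p₁ * (c₁ * Real.log p₁)) / p₀ := by field_simp
    rw [e, div_le_iff₀ hp₀pos]
    have := mul_nonpos_of_nonneg_of_nonpos hp₁pos.le hU₁
    linarith
  have hslope : 0 ≤ U₀ - U₁ + c₀ * (-Real.log r₀ - 1) + c₁ * (1 + Real.log r₁)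
      + (Real.log (1 - m) - Real.log m + Real.log 2 / m) := by linarith
  have hmain := mul_nonneg (sub_nonneg.2 hpr) hslope
  have t₀ := mul_le_mul_of_nonneg_left (neg_mul_log_sub_ge hr₀pos hp₀pos) hc₀
  have t₁ := mul_le_mul_of_nonneg_left (neg_mul_log_sub_ge hr₁pos hp₁pos) hc₁
  have e₁ : r₁ - p₁ = -(r₀ - p₀) := by linarith
  have e₂ : (r₁ - p₁) * U₁ = -(r₀ - p₀) * U₁ := by rw [e₁]
  rw [e₁] at t₁
  linarith

/-- Lemma 2 of the paper: for a binary-input DMC, if `Q` and `Q'` are input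
distributions with entries at least `Q_min > 0` and `|Q₀ − Q'₀| ≤ δ`, then
`I_LM(Q) ≥ I_LM(Q') − δ log((1 − Q_min)/Q_min) − δ log 2 / Q_min`. -/
theorem LM_rate_perturbation
    {Y : Type*} [Fintype Y]
    (W : Fin 2 → Y → ℝ) (hW0 : ∀ x y, 0 ≤ W x y) (hW1 : ∀ x, ∑ y, W x y = 1)
    (q : Fin 2 → Y → ℝ) (hq : ∀ x y, 0 ≤ q x y)
    (Qmin δ : ℝ) (hQmin : 0 < Qmin)
    (Q' Q : Fin 2 → ℝ)
    (hQ'sum : ∑ x, Q' x = 1) (hQsum : ∑ x, Q x = 1)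
    (hQ' : Qmin ≤ min (Q' 0) (Q' 1)) (hQ : Qmin ≤ min (Q 0) (Q 1))
    (hδ : |Q 0 - Q' 0| ≤ δ) :
    ILMdual W q Q ≥
      ILMdual W q Q' - δ * Real.log ((1 - Qmin) / Qmin) - δ * Real.log 2 / Qmin := by
  have hP0 : Qmin ≤ Q' 0 := hQ'.trans (min_le_left _ _)
  have hP1 : Qmin ≤ Q' 1 := hQ'.trans (min_le_right _ _)
  have hR0 : Qmin ≤ Q 0 := hQ.trans (min_le_left _ _)
  have hR1 : Qmin ≤ Q 1 := hQ.trans (min_le_right _ _)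
  have hPpos : ∀ x, 0 < Q' x := Fin.forall_fin_two.2 ⟨hQmin.trans_le hP0, hQmin.trans_le hP1⟩
  have hRpos : ∀ x, 0 < Q x := Fin.forall_fin_two.2 ⟨hQmin.trans_le hR0, hQmin.trans_le hR1⟩
  rw [Fin.sum_univ_two] at hQ'sum hQsum
  have hbdd := bddAbove_rates hW0 hW1 hq hRpos
  set C := Real.log ((1 - Qmin) / Qmin) + Real.log 2 / Qmin with hC
  have hC0 : 0 ≤ C :=
    add_nonneg (Real.log_nonneg ((one_le_div hQmin).2 (by linarith)))
      (div_nonneg (Real.log_nonneg one_le_two) hQmin.le)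
  have hδ0 : 0 ≤ δ := (abs_nonneg _).trans hδ
  have hI0 : 0 ≤ ILMdual W q Q := by
    refine le_csSup hbdd ⟨0, le_rfl, 0, ?_⟩
    simp [hQsum]
  suffices h : ILMdual W q Q' ≤ ILMdual W q Q + δ * C by
    rw [hC, mul_add] at h
    rw [mul_div_assoc]
    linarith
  refine csSup_le ⟨_, 0, le_rfl, 0, rfl⟩ ?_
  rintro r ⟨s, hs, a, rfl⟩
  have hw : ∀ x y, 0 ≤ q x y ^ s := fun x y => Real.rpow_nonneg (hq x y) s
  have hgpos : ∀ x, 0 < Q' x * Real.exp (a x) := fun x => mul_pos (hPpos x) (Real.exp_pos _)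
  have hmem := le_csSup hbdd
    ⟨s, hs, fun x => Real.log (Q' x * Real.exp (a x) / Q x), rfl⟩
  have hg : (fun x => Q x * Real.exp (Real.log (Q' x * Real.exp (a x) / Q x))) =
      fun x => Q' x * Real.exp (a x) := by
    funext x
    rw [Real.exp_log (div_pos (hgpos x) (hRpos x)), mul_div_cancel₀ _ (hRpos x).ne']
  rw [sum_rate_eq (w := fun x y => q x y ^ s) hw hRpos, hg, Fin.sum_univ_two] at hmem
  change _ ≤ ILMdual W q Q at hmem
  rw [sum_rate_eq (w := fun x y => q x y ^ s) hw hPpos, Fin.sum_univ_two]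
  have hU := posteriorLog_nonpos hW0 hw hgpos
  have hc0 := supportMass_nonneg (w := fun x y => q x y ^ s) hW0
  have hc1 := supportMass_le_one (w := fun x y => q x y ^ s) hW0 hW1
  obtain hneg | hnn := lt_or_ge
    (Q' 0 * (posteriorLog W (fun x y => q x y ^ s) (fun x => Q' x * Real.exp (a x)) 0
        - supportMass W (fun x y => q x y ^ s) 0 * Real.log (Q' 0)) +
      Q' 1 * (posteriorLog W (fun x y => q x y ^ s) (fun x => Q' x * Real.exp (a x)) 1
        - supportMass W (fun x y => q x y ^ s) 1 * Real.log (Q' 1))) 0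
  · exact hneg.le.trans (add_nonneg hI0 (mul_nonneg hδ0 hC0))
  · obtain ⟨hl, hu⟩ := abs_le.1 hδ
    obtain hle | hle := le_total (Q' 0) (Q 0)
    · have h := rate_perturbation_of_le hQmin hP0 hP1 hR1 hQ'sum hQsum hle (hc0 0) (hc1 0)
        (hc0 1) (hc1 1) (hU 1) hnn
      have := mul_le_mul_of_nonneg_right hu hC0
      linarith
    · have h := rate_perturbation_of_le hQmin hP1 hP0 hR0 ((add_comm _ _).trans hQ'sum)
        ((add_comm _ _).trans hQsum) (by linarith) (hc0 1) (hc1 1)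
        (hc0 0) (hc1 0) (hU 0) (hnn.trans_eq (add_comm _ _))
      have := mul_le_mul_of_nonneg_right (show Q 1 - Q' 1 ≤ δ by linarith) hC0
      linarith
end

section
/- Let W be a discrete memoryless channel from X = {0,1} to a finite output alphabet Y, let q : X×Y → (0,∞) be a strictly positive decoding metric, and let Q be an input distribution on {0,1} with Q₀ > 0 and Q₁ > 0. Then the dual LM rate admits the alternative representation I_LM(Q) = H(Q) − inf over s ≥ 0 and ã : X → ℝ of Σ_{x,y} Q(x) W(y|x) log( 1 + q(x̄,y)^s e^{ã(x̄)} / ( q(x,y)^s e^{ã(x)} ) ), where x̄ := 1 − x denotes the input symbol different from x and H(Q) = −Q₀ log Q₀ − Q₁ log Q₁. -/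
open scoped BigOperators

/-- Change of variable `ã(x) = a(x) + log Q(x)` in a single logarithmic term. -/
lemma log_div_sum_eq_neg_log_sub_log_one_add {u v P R b c : ℝ} (hu : 0 < u) (hv : 0 < v)
    (hP : 0 < P) (hR : 0 < R) :
    Real.log (u * Real.exp b / (P * u * Real.exp b + R * v * Real.exp c)) =
      -Real.log P - Real.log (1 + v * Real.exp (c + Real.log R) /
        (u * Real.exp (b + Real.log P))) := by
  have hb := Real.exp_pos b
  have hc := Real.exp_pos c
  rw [Real.exp_add, Real.exp_add, Real.exp_log hP, Real.exp_log hR, ← Real.log_inv,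
    ← Real.log_div (by positivity) (by positivity)]
  congr 1
  field_simp

/-- The dual LM objective at `(s, a)` is the entropy of `Q` minus the alternative objective at
`(s, a + log Q)`. -/
lemma dual_objective_eq_entropy_sub {Y : Type*} [Fintype Y]
    {W : Fin 2 → Y → ℝ} (hW1 : ∀ x, ∑ y, W x y = 1)
    {q : Fin 2 → Y → ℝ} (hq : ∀ x y, 0 < q x y)
    {Q : Fin 2 → ℝ} (hQ0 : 0 < Q 0) (hQ1 : 0 < Q 1) (s : ℝ) (a : Fin 2 → ℝ) :
    ∑ x, ∑ y, Q x * W x y * Real.log (q x y ^ s * Real.exp (a x) /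
        (∑ x', Q x' * q x' y ^ s * Real.exp (a x'))) =
      (-(Q 0 * Real.log (Q 0)) - Q 1 * Real.log (Q 1)) -
        ∑ x, ∑ y, Q x * W x y *
          Real.log (1 + q (x + 1) y ^ s * Real.exp (a (x + 1) + Real.log (Q (x + 1))) /
            (q x y ^ s * Real.exp (a x + Real.log (Q x)))) := by
  have hQ : ∀ x, 0 < Q x := by
    intro x
    fin_cases x
    · exact hQ0
    · exact hQ1
  have hsum : ∀ (f : Fin 2 → ℝ) (x : Fin 2), ∑ x', f x' = f x + f (x + 1) := by
    intro f x
    fin_cases x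
    · simp
    · simp [add_comm]
  have hterm : ∀ x, ∑ y, Q x * W x y * Real.log (q x y ^ s * Real.exp (a x) /
        (∑ x', Q x' * q x' y ^ s * Real.exp (a x'))) =
      -(Q x * Real.log (Q x)) - ∑ y, Q x * W x y *
          Real.log (1 + q (x + 1) y ^ s * Real.exp (a (x + 1) + Real.log (Q (x + 1))) /
            (q x y ^ s * Real.exp (a x + Real.log (Q x)))) := by
    intro x
    have hentropy : -(Q x * Real.log (Q x)) = ∑ y, Q x * W x y * -Real.log (Q x) := by
      rw [← Finset.sum_mul, ← Finset.mul_sum, hW1]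
      ring
    rw [hentropy, ← Finset.sum_sub_distrib]
    refine Finset.sum_congr rfl fun y _ => ?_
    rw [hsum _ x, log_div_sum_eq_neg_log_sub_log_one_add (Real.rpow_pos_of_pos (hq x y) s)
      (Real.rpow_pos_of_pos (hq (x + 1) y) s) (hQ x) (hQ (x + 1)), mul_sub]
  rw [Finset.sum_congr rfl fun x _ => hterm x, Finset.sum_sub_distrib, Fin.sum_univ_two]
  ring

/-- Alternative representation of the dual LM rate for binary-input DMCs with a
strictly positive metric and an input distribution with positive entries:
`I_LM(Q) = H(Q) − inf_{s ≥ 0, ã} Σ_{x,y} Q(x) W(y|x) log(1 + q(x̄,y)^s e^{ã(x̄)} / (q(x,y)^s e^{ã(x)}))`,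
where `x̄ = 1 − x` (in `Fin 2`, `x̄ = x + 1`). -/
theorem ILMdual_alt_representation
    {Y : Type*} [Fintype Y]
    (W : Fin 2 → Y → ℝ) (hW0 : ∀ x y, 0 ≤ W x y) (hW1 : ∀ x, ∑ y, W x y = 1)
    (q : Fin 2 → Y → ℝ) (hq : ∀ x y, 0 < q x y)
    (Q : Fin 2 → ℝ) (hQsum : ∑ x, Q x = 1) (hQ0 : 0 < Q 0) (hQ1 : 0 < Q 1) :
    ILMdual W q Q =
      (-(Q 0 * Real.log (Q 0)) - Q 1 * Real.log (Q 1)) -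
        sInf { r : ℝ | ∃ s : ℝ, 0 ≤ s ∧ ∃ a : Fin 2 → ℝ,
          r = ∑ x, ∑ y, Q x * W x y *
            Real.log (1 + q (x + 1) y ^ s * Real.exp (a (x + 1)) /
              (q x y ^ s * Real.exp (a x))) } := by
  have hQ : ∀ x, 0 < Q x := by
    intro x
    fin_cases x
    · exact hQ0
    · exact hQ1
  have hobj := dual_objective_eq_entropy_sub hW1 hq hQ0 hQ1
  set B := { r : ℝ | ∃ s : ℝ, 0 ≤ s ∧ ∃ a : Fin 2 → ℝ,
    r = ∑ x, ∑ y, Q x * W x y * Real.log (1 + q (x + 1) y ^ s * Real.exp (a (x + 1)) /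
      (q x y ^ s * Real.exp (a x))) }
  have hne : B.Nonempty := ⟨_, 0, le_rfl, fun _ => 0, rfl⟩
  have hbdd : BddBelow B := by
    refine ⟨0, ?_⟩
    rintro r ⟨s, -, a, rfl⟩
    refine Finset.sum_nonneg fun x _ => Finset.sum_nonneg fun y _ =>
      mul_nonneg (mul_nonneg (hQ x).le (hW0 x y)) (Real.log_nonneg ?_)
    have h1 := Real.rpow_pos_of_pos (hq x y) s
    have h2 := Real.rpow_pos_of_pos (hq (x + 1) y) s
    exact le_add_of_nonneg_right (by positivity)
  refine IsLUB.csSup_eq ⟨?_, ?_⟩ ⟨_, 0, le_rfl, fun _ => 0, rfl⟩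
  · rintro r ⟨s, hs, a, rfl⟩
    rw [hobj s a]
    exact sub_le_sub_left (csInf_le hbdd ⟨s, hs, fun x => a x + Real.log (Q x), rfl⟩) _
  · intro c hc
    rw [sub_le_comm]
    refine le_csInf hne ?_
    rintro r ⟨s, hs, a, rfl⟩
    have h := hc ⟨s, hs, fun x => a x - Real.log (Q x), rfl⟩
    rw [hobj] at h
    simp only [sub_add_cancel] at h
    exact sub_le_comm.mp h
end
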